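/- For any nonzero L ∈ ℝ^{m×n} of rank r ≤ k and any nonempty Ω ⊂ {1,…,m}×{1,…,n}, there exists S supported on Ω such that inf_{X ∈ ℝ^{m×k}, Y ∈ ℝ^{n×k}} ‖XYᵀ − (L+S)‖₁ < ‖S‖₁; i.e., the true factorization value ‖S‖₁ = f(X*,Y*) is not the global minimum of f. -/

import Mathlib

open Matrix

noncomputable def l1norm {a b : ℕ} (A : Matrix (Fin a) (Fin b) ℝ) : ℝ :=
  ∑ i, ∑ j, |A i j|

/-- A matrix of rank at most `k` factors through a `k`-dimensional space. -/
theorem Matrix.exists_eq_mul_transpose_of_rank_le {K m n : Type*} [Field K] [Fintype m]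
    [Fintype n] {k : ℕ} (A : Matrix m n K) (hA : A.rank ≤ k) :
    ∃ (X : Matrix m (Fin k) K) (Y : Matrix n (Fin k) K), A = X * Yᵀ := by
  classical
  have hfin : Module.finrank K A.mulVecLin.range ≤ Module.finrank K (Fin k → K) := by
    simpa [Matrix.rank] using hA
  obtain ⟨f, hf⟩ := finrank_le_iff_exists_linearMap.mp hfin
  obtain ⟨g, hg⟩ := f.exists_leftInverse_of_injective (LinearMap.ker_eq_bot.mpr hf)
  refine ⟨LinearMap.toMatrix' (A.mulVecLin.range.subtype ∘ₗ g),
    (LinearMap.toMatrix' (f ∘ₗ A.mulVecLin.rangeRestrict))ᵀ, ?_⟩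
  rw [transpose_transpose, ← LinearMap.toMatrix'_comp]
  have hcomp : (A.mulVecLin.range.subtype ∘ₗ g) ∘ₗ (f ∘ₗ A.mulVecLin.rangeRestrict)
      = A.mulVecLin := by
    refine LinearMap.ext fun x => ?_
    exact congrArg Subtype.val (LinearMap.congr_fun hg (A.mulVecLin.rangeRestrict x))
  rw [hcomp, ← Matrix.toLin'_apply', LinearMap.toMatrix'_toLin']

theorem l1norm_nonneg {a b : ℕ} (A : Matrix (Fin a) (Fin b) ℝ) : 0 ≤ l1norm A :=
  Finset.sum_nonneg fun _ _ => Finset.sum_nonneg fun _ _ => abs_nonneg _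

theorem l1norm_add_le {a b : ℕ} (A B : Matrix (Fin a) (Fin b) ℝ) :
    l1norm (A + B) ≤ l1norm A + l1norm B := by
  simp only [l1norm, ← Finset.sum_add_distrib]
  exact Finset.sum_le_sum fun _ _ => Finset.sum_le_sum fun _ _ => abs_add_le _ _

theorem l1norm_smul {a b : ℕ} (c : ℝ) (A : Matrix (Fin a) (Fin b) ℝ) :
    l1norm (c • A) = |c| * l1norm A := by
  simp [l1norm, abs_mul, Finset.mul_sum]

theorem l1norm_single {a b : ℕ} (i : Fin a) (j : Fin b) (c : ℝ) :
    l1norm (single i j c) = |c| := by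
  rw [l1norm, Finset.sum_eq_single i, Finset.sum_eq_single j]
  · simp
  · intro b _ hb
    simp [hb.symm]
  · simp
  · intro a _ ha
    simp [ha.symm]
  · simp

/-- the ground truth is in general not globally optimal.  For any
nonzero `L` of rank `r ≤ k` and any nonempty `Ω`, there exists `S` supported on
`Ω` with `inf_{X,Y} ‖XYᵀ - (L+S)‖₁ < ‖S‖₁`. -/
theorem ground_truth_not_global_min
    {m n r k : ℕ}
    (L : Matrix (Fin m) (Fin n) ℝ) (hL : L ≠ 0)
    (hrank : L.rank = r) (hrk : r ≤ k)
    (Ω : Set (Fin m × Fin n)) (hΩ : Ω.Nonempty) :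
    ∃ S : Matrix (Fin m) (Fin n) ℝ,
      (∀ i j, (i, j) ∉ Ω → S i j = 0) ∧
      sInf {c : ℝ | ∃ (X : Matrix (Fin m) (Fin k) ℝ) (Y : Matrix (Fin n) (Fin k) ℝ),
          c = l1norm (X * Yᵀ - (L + S))} < l1norm S := by
  obtain ⟨⟨i, j⟩, hij⟩ := hΩ
  obtain ⟨X, Y, rfl⟩ := L.exists_eq_mul_transpose_of_rank_le (hrank.trans_le hrk)
  obtain ⟨p⟩ : Nonempty (Fin k) := by
    by_contra h
    rw [not_nonempty_iff] at h
    exact hL (by ext; simp [Matrix.mul_apply])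
  let E : Matrix (Fin m) (Fin k) ℝ := single i p 1
  let F : Matrix (Fin n) (Fin k) ℝ := single j p 1
  let t : ℝ := l1norm (E * Yᵀ) + l1norm (X * Fᵀ) + 1
  have ht : 0 < t := by
    linarith [l1norm_nonneg (E * Yᵀ), l1norm_nonneg (X * Fᵀ),
      show t = l1norm (E * Yᵀ) + l1norm (X * Fᵀ) + 1 from rfl]
  have hEF : E * Fᵀ = single i j 1 := by simp [E, F]
  refine ⟨t ^ 2 • single i j 1, ?_, ?_⟩
  · intro a b hab
    rw [Matrix.smul_apply, single_apply_of_ne, smul_zero]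
    rintro ⟨rfl, rfl⟩
    exact hab hij
  have hres : (X + t • E) * (Y + t • F)ᵀ - (X * Yᵀ + t ^ 2 • single i j 1)
      = t • (E * Yᵀ + X * Fᵀ) := by
    rw [← hEF]
    simp only [transpose_add, transpose_smul, Matrix.add_mul, Matrix.mul_add, Matrix.smul_mul,
      Matrix.mul_smul]
    module
  refine lt_of_le_of_lt (csInf_le ⟨0, ?_⟩ ⟨X + t • E, Y + t • F, rfl⟩) ?_
  · rintro _ ⟨X', Y', rfl⟩
    exact l1norm_nonneg _
  calc l1norm ((X + t • E) * (Y + t • F)ᵀ - (X * Yᵀ + t ^ 2 • single i j 1))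
      = t * l1norm (E * Yᵀ + X * Fᵀ) := by rw [hres, l1norm_smul, abs_of_pos ht]
    _ ≤ t * (l1norm (E * Yᵀ) + l1norm (X * Fᵀ)) := by
        gcongr
        exact l1norm_add_le _ _
    _ < t * t := by
        gcongr
        exact lt_add_one _
    _ = l1norm (t ^ 2 • single i j 1) := by
        rw [l1norm_smul, l1norm_single, abs_one, mul_one, abs_of_nonneg (sq_nonneg t), sq]
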